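/- arXiv:1903.04009 — 8 statements merged into one kernel-verified Lean document; each statement's English description precedes it below -/
import Mathlib

section
/- Let 𝒜 be the family of Lebesgue-measurable subsets A of (0,∞) satisfying λ(A) ≤ √(inf A), and for measurable f : (0,∞) → [0,∞] define ρ_Y(f) = sup_{A ∈ 𝒜} ∫_A f(t) dt. Then for every b > 0: (i) ρ_Y(1_{(0,b]}) ≤ √b, and (ii) for every c ≥ b², ρ_Y(1_{(c,c+b]}) = b. -/
open MeasureTheory Set ENNReal

/-- The function norm `ρ_Y f = sup { ∫_A f : A ⊆ (0,∞) Lebesgue-measurable, λ(A) ≤ √(inf A) }`. -/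
noncomputable def rhoY (f : ℝ → ℝ≥0∞) : ℝ≥0∞ :=
  ⨆ (A : Set ℝ) (_ : A ⊆ Ioi 0) (_ : NullMeasurableSet A volume)
    (_ : volume A ≤ ENNReal.ofReal (Real.sqrt (sInf A))),
    ∫⁻ t in A, f t

/-- The integral of a characteristic function over `A` is the measure of the intersection. -/
theorem setLIntegral_indicator_Ioc_one (A : Set ℝ) (a b : ℝ) :
    ∫⁻ t in A, (Ioc a b).indicator (fun _ => (1 : ℝ≥0∞)) t = volume (Ioc a b ∩ A) := by
  rw [lintegral_indicator_const measurableSet_Ioc, one_mul,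
    Measure.restrict_apply measurableSet_Ioc]

/-- For every `b > 0`: (i) `ρ_Y(1_{(0,b]}) ≤ √b`, and
(ii) for every `c ≥ b²`, `ρ_Y(1_{(c,c+b]}) = b`. -/
theorem stmt1 (b : ℝ) (hb : 0 < b) :
    rhoY ((Ioc (0:ℝ) b).indicator fun _ => (1 : ℝ≥0∞)) ≤ ENNReal.ofReal (Real.sqrt b) ∧
    ∀ c : ℝ, b ^ 2 ≤ c →
      rhoY ((Ioc c (c + b)).indicator fun _ => (1 : ℝ≥0∞)) = ENNReal.ofReal b := by
  refine ⟨?_, fun c hc => le_antisymm ?_ ?_⟩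
  · refine iSup_le fun A => iSup_le fun hA => iSup_le fun _ => iSup_le fun hvol => ?_
    rw [setLIntegral_indicator_Ioc_one]
    rcases le_or_gt (sInf A) b with h | h
    · exact (measure_mono inter_subset_right).trans
        (hvol.trans (ENNReal.ofReal_le_ofReal (Real.sqrt_le_sqrt h)))
    · have hempty : Ioc 0 b ∩ A = ∅ := eq_empty_of_forall_notMem fun x hx =>
        absurd (csInf_le ⟨0, fun y hy => (hA hy).le⟩ hx.2) (not_le.2 (hx.1.2.trans_lt h))
      simp [hempty]
  · refine iSup_le fun A => iSup_le fun _ => iSup_le fun _ => iSup_le fun _ => ?_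
    rw [setLIntegral_indicator_Ioc_one]
    refine (measure_mono inter_subset_left).trans ?_
    simp
  · have hc0 : 0 ≤ c := (sq_nonneg b).trans hc
    have hvol : volume (Ioc c (c + b)) ≤ ENNReal.ofReal (Real.sqrt (sInf (Ioc c (c + b)))) := by
      rw [csInf_Ioc (lt_add_of_pos_right c hb), Real.volume_Ioc, add_sub_cancel_left]
      exact ENNReal.ofReal_le_ofReal (Real.le_sqrt_of_sq_le hc)
    refine le_trans (le_of_eq ?_) (le_iSup_of_le (Ioc c (c + b)) (le_iSup_of_le
      (fun x hx => hc0.trans_lt hx.1) (le_iSup_of_le measurableSet_Ioc.nullMeasurableSet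
        (le_iSup_of_le hvol le_rfl))))
    rw [setLIntegral_indicator_Ioc_one, inter_self, Real.volume_Ioc, add_sub_cancel_left]
end

section
/- Fix 1 ≤ p < ∞ and W ∈ 𝕎. Then the Garling function norm ρ_G is subrearrangement-invariant: for every Lebesgue-measurable set D ⊆ (0,∞), every MO-isomorphism n : (0,∞) → D, and every measurable f : (0,∞) → ℝ with ρ_G(|f|) < ∞, one has ρ_G(|f ∘ n|) = ρ_G(|f · 1_D|). -/
open MeasureTheory Set ENNReal Filter

/-- An MO-isomorphism between subsets `E, F` of `ℝ`: a strictly increasing bijection from `E`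
onto `F` such that both it and its inverse are measure-preserving for Lebesgue measure. -/
structure MOIso (E F : Set ℝ) (m : ℝ → ℝ) : Prop where
  bijOn : Set.BijOn m E F
  strictMonoOn : StrictMonoOn m E
  measPres : ∀ A : Set ℝ, A ⊆ F → NullMeasurableSet A volume →
    NullMeasurableSet (E ∩ m ⁻¹' A) volume ∧ volume (E ∩ m ⁻¹' A) = volume A
  invMeasPres : ∀ B : Set ℝ, B ⊆ E → NullMeasurableSet B volume →
    NullMeasurableSet (m '' B) volume ∧ volume (m '' B) = volume B

/-- The class `𝕎` of weights: nonincreasing Lebesgue-measurable `W : (0,∞) → (0,∞)` with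
`W(t) → 0` as `t → ∞`, `∫_0^∞ W = ∞` and `∫_0^1 W < ∞`. -/
def memW (W : ℝ → ℝ) : Prop :=
  AntitoneOn W (Ioi 0) ∧ (∀ t ∈ Ioi (0:ℝ), 0 < W t) ∧ AEMeasurable W volume ∧
    Tendsto W atTop (nhds 0) ∧
    (∫⁻ t in Ioi (0:ℝ), ENNReal.ofReal (W t)) = ∞ ∧
    (∫⁻ t in Ioc (0:ℝ) 1, ENNReal.ofReal (W t)) < ∞

/-- The Garling function norm
`ρ_G(f) = sup over E, F ⊆ (0,∞) and MO-isomorphisms m : E → F of (∫_E f(m t)^p W(t) dt)^{1/p}`. -/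
noncomputable def rhoG (p : ℝ) (W : ℝ → ℝ) (f : ℝ → ℝ≥0∞) : ℝ≥0∞ :=
  ⨆ (E : Set ℝ) (F : Set ℝ) (m : ℝ → ℝ) (_ : E ⊆ Ioi 0) (_ : F ⊆ Ioi 0)
    (_ : NullMeasurableSet E volume) (_ : NullMeasurableSet F volume) (_ : MOIso E F m),
    (∫⁻ t in E, f (m t) ^ p * ENNReal.ofReal (W t)) ^ (1 / p)

namespace MOIso

variable {E F G : Set ℝ} {m k : ℝ → ℝ}

/-- MO-isomorphisms compose. -/
theorem comp (hk : MOIso F G k) (hm : MOIso E F m) : MOIso E G (k ∘ m) where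
  bijOn := hk.bijOn.comp hm.bijOn
  strictMonoOn := hk.strictMonoOn.comp hm.strictMonoOn hm.bijOn.mapsTo
  measPres A hA hAm := by
    have hEq : E ∩ (k ∘ m) ⁻¹' A = E ∩ m ⁻¹' (F ∩ k ⁻¹' A) := by
      ext x
      exact ⟨fun hx => ⟨hx.1, hm.bijOn.mapsTo hx.1, hx.2⟩, fun hx => ⟨hx.1, hx.2.2⟩⟩
    obtain ⟨h₁, h₂⟩ := hk.measPres A hA hAm
    obtain ⟨h₃, h₄⟩ := hm.measPres _ inter_subset_left h₁
    rw [hEq]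
    exact ⟨h₃, h₄.trans h₂⟩
  invMeasPres B hB hBm := by
    obtain ⟨h₁, h₂⟩ := hm.invMeasPres B hB hBm
    obtain ⟨h₃, h₄⟩ := hk.invMeasPres _ ((image_mono hB).trans hm.bijOn.image_eq.subset) h₁
    rw [image_comp]
    exact ⟨h₃, h₄.trans h₂⟩

/-- An MO-isomorphism restricts to an MO-isomorphism from any subset onto its image. -/
theorem restrict (hm : MOIso E F m) {B : Set ℝ} (hB : B ⊆ E) : MOIso B (m '' B) m where
  bijOn := (hm.bijOn.injOn.mono hB).bijOn_image
  strictMonoOn := hm.strictMonoOn.mono hB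
  measPres A hA hAm := by
    have hEq : B ∩ m ⁻¹' A = E ∩ m ⁻¹' A := by
      ext x
      refine ⟨fun hx => ⟨hB hx.1, hx.2⟩, fun hx => ⟨?_, hx.2⟩⟩
      obtain ⟨y, hy, hyx⟩ := hA hx.2
      rwa [← hm.bijOn.injOn (hB hy) hx.1 hyx]
    rw [hEq]
    exact hm.measPres A (hA.trans ((image_mono hB).trans hm.bijOn.image_eq.subset)) hAm
  invMeasPres A hA hAm := hm.invMeasPres A (hA.trans hB) hAm

/-- The inverse of an MO-isomorphism is an MO-isomorphism. -/
theorem symm (hm : MOIso E F m) : MOIso F E (Function.invFunOn m E) where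
  bijOn := hm.bijOn.symm hm.bijOn.invOn_invFunOn.symm
  strictMonoOn x hx y hy hxy := by
    have hmaps := hm.bijOn.surjOn.mapsTo_invFunOn
    have hright := hm.bijOn.invOn_invFunOn.2
    rwa [← hm.strictMonoOn.lt_iff_lt (hmaps hx) (hmaps hy), hright hx, hright hy]
  measPres A hA hAm := by
    have hEq : F ∩ Function.invFunOn m E ⁻¹' A = m '' A := by
      rw [← hm.bijOn.image_eq, inter_comm, ← hm.bijOn.invOn_invFunOn.1.image_inter',
        inter_eq_self_of_subset_left hA]
    rw [hEq]
    exact hm.invMeasPres A hA hAm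
  invMeasPres B hB hBm := by
    have hEq : Function.invFunOn m E '' B = E ∩ m ⁻¹' B := by
      ext x
      constructor
      · rintro ⟨y, hy, rfl⟩
        refine ⟨hm.bijOn.surjOn.mapsTo_invFunOn (hB hy), ?_⟩
        rwa [mem_preimage, hm.bijOn.invOn_invFunOn.2 (hB hy)]
      · exact fun hx => ⟨m x, hx.2, hm.bijOn.invOn_invFunOn.1 hx.1⟩
    rw [hEq]
    exact hm.measPres B hB hBm

end MOIso

/-- Each MO-isomorphism between measurable subsets of `(0,∞)` gives a lower bound for `rhoG`. -/
theorem le_rhoG (p : ℝ) (W : ℝ → ℝ) (g : ℝ → ℝ≥0∞) {E F : Set ℝ} {m : ℝ → ℝ}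
    (hE : E ⊆ Ioi 0) (hF : F ⊆ Ioi 0) (hEm : NullMeasurableSet E volume)
    (hFm : NullMeasurableSet F volume) (hm : MOIso E F m) :
    (∫⁻ t in E, g (m t) ^ p * ENNReal.ofReal (W t)) ^ (1 / p) ≤ rhoG p W g := by
  unfold rhoG
  exact le_iSup_of_le E <| le_iSup_of_le F <| le_iSup_of_le m <| le_iSup_of_le hE <|
    le_iSup_of_le hF <| le_iSup_of_le hEm <| le_iSup_of_le hFm <| le_iSup_of_le hm le_rfl

/-- To bound `rhoG` it suffices to bound the contribution of each MO-isomorphism. -/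
theorem rhoG_le {p : ℝ} {W : ℝ → ℝ} {g : ℝ → ℝ≥0∞} {c : ℝ≥0∞}
    (h : ∀ (E F : Set ℝ) (m : ℝ → ℝ), E ⊆ Ioi 0 → F ⊆ Ioi 0 → NullMeasurableSet E volume →
      NullMeasurableSet F volume → MOIso E F m →
      (∫⁻ t in E, g (m t) ^ p * ENNReal.ofReal (W t)) ^ (1 / p) ≤ c) :
    rhoG p W g ≤ c := by
  unfold rhoG
  exact iSup_le fun E => iSup_le fun F => iSup_le fun m => iSup_le fun hE => iSup_le fun hF =>
    iSup_le fun hEm => iSup_le fun hFm => iSup_le fun hm => h E F m hE hF hEm hFm hm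

/-- For `1 ≤ p < ∞` and `W ∈ 𝕎`, the Garling function norm is
subrearrangement-invariant. -/
theorem stmt4 (p : ℝ) (hp : 1 ≤ p) (W : ℝ → ℝ) (hW : memW W)
    (D : Set ℝ) (hD : D ⊆ Ioi 0) (hDm : NullMeasurableSet D volume)
    (n : ℝ → ℝ) (hn : MOIso (Ioi 0) D n)
    (f : ℝ → ℝ) (hf : Measurable f)
    (hfin : rhoG p W (fun t => ENNReal.ofReal |f t|) < ∞) :
    rhoG p W (fun t => ENNReal.ofReal |f (n t)|) =
      rhoG p W (fun t => ENNReal.ofReal |D.indicator f t|) := by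
  have hp₀ : 0 < p := zero_lt_one.trans_le hp
  apply le_antisymm
  · refine rhoG_le fun E F m hE hF hEm hFm hm => ?_
    have hFD : n '' F ⊆ D := (image_mono hF).trans hn.bijOn.image_eq.subset
    refine le_of_eq_of_le ?_ (le_rhoG p W _ hE (hFD.trans hD) hEm
      (hn.invMeasPres F hF hFm).1 ((hn.restrict hF).comp hm))
    congr 1
    rw [← lintegral_indicator₀ hEm, ← lintegral_indicator₀ hEm]
    refine lintegral_congr fun t => congr_fun (indicator_congr fun t ht => ?_) t
    have hmem : n (m t) ∈ D := hFD (mem_image_of_mem n (hm.bijOn.mapsTo ht))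
    simp [hmem]
  · refine rhoG_le fun E F m hE hF hEm hFm hm => ?_
    set E' := E ∩ m ⁻¹' (F ∩ D)
    have hE'm : NullMeasurableSet E' volume :=
      (hm.measPres _ inter_subset_left (hFm.inter hDm)).1
    have hE'D : m '' E' ⊆ D := by
      rintro _ ⟨t, ht, rfl⟩
      exact ht.2.2
    have hE'im := (hm.invMeasPres E' inter_subset_left hE'm).1
    have hk := hn.symm
    refine le_of_eq_of_le ?_ (le_rhoG p W _ (inter_subset_left.trans hE)
      ((image_mono hE'D).trans hk.bijOn.image_eq.subset) hE'm
      (hk.invMeasPres _ hE'D hE'im).1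
      ((hk.restrict hE'D).comp (hm.restrict inter_subset_left)))
    congr 1
    rw [← lintegral_indicator₀ hEm, ← lintegral_indicator₀ hE'm]
    refine lintegral_congr fun t => ?_
    by_cases ht : t ∈ E
    · by_cases hmem : m t ∈ D
      · have ht' : t ∈ E' := ⟨ht, hm.bijOn.mapsTo ht, hmem⟩
        simp [ht, ht', hmem, hn.bijOn.invOn_invFunOn.2 hmem]
      · have ht' : t ∉ E' := fun h => hmem h.2.2
        simp [ht', hmem, hp₀]
    · have ht' : t ∉ E' := fun h => ht h.1
      simp [ht, ht']
end

section
/- Let W(t) = (t+1)^{-1/2} and p = 1. For r ∈ (0,∞), define f_r(t) = (r+1-t)^{-1/2} for 0 < t < r and f_r(t) = 0 for t ≥ r, and f_r*(t) = (t+1)^{-1/2} for 0 < t < r and f_r*(t) = 0 for t ≥ r. Then ρ_G(f_r*) ≥ log(r+1) and ρ_G(f_r) ≤ 4. -/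
open MeasureTheory Set ENNReal Filter

/-- A function that is at least `k` on `I` and at most `k` on `A \ I` has a larger integral over `I`
than over any set `A` of no larger measure. -/
lemma setLIntegral_le_of_superlevel {α : Type*} [MeasurableSpace α] {μ : Measure α}
    {A I : Set α} {h : α → ℝ≥0∞} {k : ℝ≥0∞}
    (hA : NullMeasurableSet A μ) (hI : NullMeasurableSet I μ) (hIfin : μ I ≠ ∞) (hAI : μ A ≤ μ I)
    (hge : ∀ x ∈ I, k ≤ h x) (hle : ∀ x ∈ A \ I, h x ≤ k) :
    ∫⁻ x in A, h x ∂μ ≤ ∫⁻ x in I, h x ∂μ := by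
  have hdiff : μ (A \ I) ≤ μ (I \ A) := by
    have h1 := measure_inter_add_sdiff₀ A hI
    have h2 := measure_inter_add_sdiff₀ I hA
    rw [inter_comm] at h2
    rw [← h1, ← h2] at hAI
    exact (ENNReal.add_le_add_iff_left
      (ne_top_of_le_ne_top hIfin (measure_mono inter_subset_right))).1 hAI
  calc ∫⁻ x in A, h x ∂μ
      ≤ ∫⁻ x in A ∩ I, h x ∂μ + ∫⁻ x in A \ I, h x ∂μ := by
        conv_lhs => rw [← inter_union_sdiff A I]
        exact lintegral_union_le _ _ _
    _ ≤ ∫⁻ x in A ∩ I, h x ∂μ + ∫⁻ x in I \ A, h x ∂μ := by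
        refine add_le_add le_rfl ?_
        calc ∫⁻ x in A \ I, h x ∂μ ≤ ∫⁻ _ in A \ I, k ∂μ := by
              apply lintegral_mono_ae
              filter_upwards [ae_restrict_mem₀ (hA.diff hI)] with x hx using hle x hx
          _ ≤ ∫⁻ _ in I \ A, k ∂μ := by
              simp only [setLIntegral_const]
              gcongr
          _ ≤ _ := by
              apply lintegral_mono_ae
              filter_upwards [ae_restrict_mem₀ (hI.diff hA)] with x hx using hge x hx.1
    _ = ∫⁻ x in I, h x ∂μ := by
        rw [inter_comm A I, ← lintegral_add_measure, Measure.restrict_inter_add_sdiff₀ I hA]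

/-- A subset of `(0, r)` can be cut at a point into two pieces of equal measure. -/
lemma exists_half_measure {A : Set ℝ} {r : ℝ} (hr : 0 ≤ r) (hAr : A ⊆ Ioo 0 r) :
    ∃ b : ℝ, 0 ≤ b ∧ ∃ d : ℝ, volume (A ∩ Iio d) = ENNReal.ofReal b ∧
      volume (A ∩ Ici d) = ENNReal.ofReal b := by
  have hfin : ∀ S : Set ℝ, volume (A ∩ S) ≠ ∞ := fun S =>
    ne_top_of_le_ne_top (by simp) (measure_mono (inter_subset_left.trans hAr))
  have hlip : LipschitzWith 1 (fun d : ℝ => volume.real (A ∩ Iio d)) := by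
    refine LipschitzWith.of_le_add fun x y => ?_
    calc volume.real (A ∩ Iio x) ≤ volume.real (A ∩ Iio y ∪ Icc y x) := by
          refine measureReal_mono ?_
            (measure_union_ne_top (hfin _) (by simp))
          rintro z ⟨hz, hzx⟩
          by_cases hzy : z < y
          · exact Or.inl ⟨hz, hzy⟩
          · exact Or.inr ⟨not_lt.1 hzy, le_of_lt hzx⟩
      _ ≤ volume.real (A ∩ Iio y) + volume.real (Icc y x) := measureReal_union_le _ _
      _ ≤ _ := by
          gcongr
          rw [Measure.real, Real.volume_Icc, ENNReal.toReal_ofReal', Real.dist_eq]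
          exact max_le (le_abs_self _) (abs_nonneg _)
  have h0 : volume.real (A ∩ Iio 0) = 0 := by
    have : A ∩ Iio 0 = ∅ := by
      ext x
      simp only [mem_inter_iff, mem_Iio, mem_empty_iff_false, iff_false, not_and, not_lt]
      exact fun hx => (hAr hx).1.le
    simp [this]
  have hr' : A ∩ Iio r = A := inter_eq_left.2 fun x hx => (hAr hx).2
  have hAle : volume.real A ≤ r := by
    calc volume.real A ≤ volume.real (Ioo 0 r) := measureReal_mono hAr (by simp)
      _ = r := by simp [Measure.real, hr]
  have hA0 : 0 ≤ volume.real A := measureReal_nonneg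
  obtain ⟨d, -, hd⟩ := intermediate_value_Icc hr hlip.continuous.continuousOn
    (show volume.real A / 2 ∈ Icc (volume.real (A ∩ Iio 0)) (volume.real (A ∩ Iio r)) by
      rw [h0, hr']; constructor <;> linarith)
  simp only at hd
  refine ⟨volume.real A / 2, by positivity, d, ?_, ?_⟩
  · rw [← hd, ofReal_measureReal (hfin _)]
  · have hsplit : volume.real (A ∩ Iio d) + volume.real (A ∩ Ici d) = volume.real A := by
      have hc : A ∩ Ici d = A \ Iio d := by rw [sdiff_eq, compl_Iio]
      rw [hc]
      exact measureReal_inter_add_sdiff measurableSet_Iio (by simpa using hfin univ)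
    rw [← ofReal_measureReal (hfin _)]
    congr 1
    linarith

/-- Change of variables along an MO-isomorphism. -/
lemma MOIso.setLIntegral_comp {E F V : Set ℝ} {m : ℝ → ℝ} (hm : MOIso E F m)
    (hE : NullMeasurableSet E volume) (hVF : V ⊆ F)
    (hV : NullMeasurableSet V volume) {f : ℝ → ℝ≥0∞} (hf : Measurable f) :
    ∫⁻ t in E ∩ m ⁻¹' V, f (m t) = ∫⁻ s in V, f s := by
  have hmE : AEMeasurable m (volume.restrict E) := by
    obtain ⟨E₁, hE₁, hmeas, hae⟩ := hE.exists_measurable_subset_ae_eq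
    rw [← Measure.restrict_congr_set hae]
    exact aemeasurable_restrict_of_monotoneOn hmeas (hm.strictMonoOn.monotoneOn.mono hE₁)
  have hmU : AEMeasurable m (volume.restrict (E ∩ m ⁻¹' V)) :=
    hmE.mono_measure (Measure.restrict_mono inter_subset_left le_rfl)
  have hmap : (volume.restrict (E ∩ m ⁻¹' V)).map m = volume.restrict V := by
    ext B hB
    rw [Measure.map_apply_of_aemeasurable hmU hB, Measure.restrict_apply hB,
      Measure.restrict_apply₀' (hm.measPres V hVF hV).1]
    have h := (hm.measPres (B ∩ V) (inter_subset_right.trans hVF)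
      (hB.nullMeasurableSet.inter hV)).2
    rw [← h]
    congr 1
    ext x
    simp only [mem_inter_iff, mem_preimage]
    tauto
  rw [← hmap, lintegral_map' hf.aemeasurable hmU]

lemma setLIntegral_inv_sqrt_add_one_le {b : ℝ} (hb : 0 ≤ b) :
    ∫⁻ t in Ioc 0 b, ENNReal.ofReal ((t + 1) ^ (-(1/2) : ℝ)) ≤
      ENNReal.ofReal (2 * (b + 1) ^ (1/2 : ℝ)) := by
  have hcont : ContinuousOn (fun t : ℝ => (t + 1) ^ (-(1/2) : ℝ)) (Icc 0 b) := by
    refine ContinuousOn.rpow_const (by fun_prop) fun x hx => Or.inl ?_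
    linarith [hx.1]
  rw [← ofReal_integral_eq_lintegral_ofReal
    (hcont.integrableOn_Icc.mono_set Ioc_subset_Icc_self)
    (by
      filter_upwards [ae_restrict_mem measurableSet_Ioc] with x hx
      exact Real.rpow_nonneg (by linarith [hx.1]) _),
    ← intervalIntegral.integral_of_le hb]
  apply ENNReal.ofReal_le_ofReal
  rw [intervalIntegral.integral_comp_add_right (fun x : ℝ => x ^ (-(1/2) : ℝ)) 1,
    integral_rpow (Or.inl (by norm_num))]
  norm_num
  linarith

lemma setLIntegral_inv_sqrt_sub_le {b r : ℝ} (hb : 0 ≤ b) :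
    ∫⁻ t in Ico (r - b) r, ENNReal.ofReal (if t < r then (r + 1 - t) ^ (-(1/2) : ℝ) else 0) ≤
      ENNReal.ofReal (2 * (b + 1) ^ (1/2 : ℝ)) := by
  have hcont : ContinuousOn (fun t : ℝ => (r + 1 - t) ^ (-(1/2) : ℝ)) (Icc (r - b) r) := by
    refine ContinuousOn.rpow_const (by fun_prop) fun x hx => Or.inl ?_
    linarith [hx.2]
  rw [setLIntegral_congr_fun (g := fun t => ENNReal.ofReal ((r + 1 - t) ^ (-(1/2) : ℝ)))
    measurableSet_Ico (fun t ht => by simp [ht.2]),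
    Measure.restrict_congr_set Ico_ae_eq_Ioc,
    ← ofReal_integral_eq_lintegral_ofReal
    (hcont.integrableOn_Icc.mono_set Ioc_subset_Icc_self)
    (by
      filter_upwards [ae_restrict_mem measurableSet_Ioc] with x hx
      exact Real.rpow_nonneg (by linarith [hx.2]) _),
    ← intervalIntegral.integral_of_le (by linarith)]
  apply ENNReal.ofReal_le_ofReal
  rw [intervalIntegral.integral_comp_sub_left (fun x : ℝ => x ^ (-(1/2) : ℝ)) (r + 1),
    integral_rpow (Or.inl (by norm_num))]
  rw [show r + 1 - (r - b) = b + 1 by ring]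
  norm_num
  linarith

lemma ofReal_inv_sqrt_mul_two_sqrt {b : ℝ} (hb : 0 ≤ b) :
    ENNReal.ofReal ((b + 1) ^ (-(1/2) : ℝ)) * ENNReal.ofReal (2 * (b + 1) ^ (1/2 : ℝ)) = 2 := by
  have hb1 : 0 < b + 1 := by linarith
  rw [← ENNReal.ofReal_mul (by positivity), mul_left_comm, ← Real.rpow_add hb1]
  norm_num

lemma MOIso.refl (E : Set ℝ) : MOIso E E id where
  bijOn := bijOn_id E
  strictMonoOn := strictMono_id.strictMonoOn E
  measPres A hA hAm := by
    rw [preimage_id, inter_eq_right.2 hA]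
    exact ⟨hAm, rfl⟩
  invMeasPres B _ hBm := by
    rw [image_id]
    exact ⟨hBm, rfl⟩

lemma ofReal_log_le_rhoG {r : ℝ} (hr : 0 < r) :
    ENNReal.ofReal (Real.log (r + 1)) ≤
      rhoG 1 (fun t => (t + 1) ^ (-(1/2) : ℝ))
        (fun t => ENNReal.ofReal (if t < r then (t + 1) ^ (-(1/2) : ℝ) else 0)) := by
  have hE : NullMeasurableSet (Ioo 0 r) volume := measurableSet_Ioo.nullMeasurableSet
  refine le_trans ?_ (le_iSup_of_le (Ioo 0 r) <| le_iSup_of_le (Ioo 0 r) <| le_iSup_of_le id <|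
    le_iSup_of_le Ioo_subset_Ioi_self <| le_iSup_of_le Ioo_subset_Ioi_self <|
    le_iSup_of_le hE <| le_iSup_of_le hE <| le_iSup_of_le (MOIso.refl _) le_rfl)
  simp only [id, ENNReal.rpow_one, div_one]
  rw [setLIntegral_congr_fun (g := fun t => ENNReal.ofReal ((t + 1)⁻¹)) measurableSet_Ioo
    (fun t ht => by
      have ht1 : 0 < t + 1 := by linarith [ht.1]
      simp only [ht.2, if_true]
      rw [← ENNReal.ofReal_mul (by positivity), ← Real.rpow_add ht1]
      norm_num [Real.rpow_neg_one]),
    Measure.restrict_congr_set Ioo_ae_eq_Ioc]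
  have hcont : ContinuousOn (fun t : ℝ => (t + 1)⁻¹) (Icc 0 r) := by
    refine ContinuousOn.inv₀ (by fun_prop) fun x hx => ?_
    linarith [hx.1]
  rw [← ofReal_integral_eq_lintegral_ofReal
    (hcont.integrableOn_Icc.mono_set Ioc_subset_Icc_self)
    (by
      filter_upwards [ae_restrict_mem measurableSet_Ioc] with x hx
      exact inv_nonneg.2 (by linarith [hx.1])),
    ← intervalIntegral.integral_of_le hr.le,
    intervalIntegral.integral_comp_add_right (fun x : ℝ => x⁻¹) 1,
    integral_inv_of_pos (by norm_num) (by linarith)]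
  simp

lemma MOIso.setLIntegral_le_four {r : ℝ} (hr : 0 < r) {E F : Set ℝ} {m : ℝ → ℝ}
    (hm : MOIso E F m) (hE0 : E ⊆ Ioi 0) (hF0 : F ⊆ Ioi 0) (hE : NullMeasurableSet E volume)
    (hF : NullMeasurableSet F volume) :
    ∫⁻ t in E, ENNReal.ofReal (if m t < r then (r + 1 - m t) ^ (-(1/2) : ℝ) else 0) *
      ENNReal.ofReal ((t + 1) ^ (-(1/2) : ℝ)) ≤ 4 := by
  set f : ℝ → ℝ≥0∞ :=
    fun s => ENNReal.ofReal (if s < r then (r + 1 - s) ^ (-(1/2) : ℝ) else 0) with hf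
  set w : ℝ → ℝ≥0∞ := fun t => ENNReal.ofReal ((t + 1) ^ (-(1/2) : ℝ)) with hw
  change ∫⁻ t in E, f (m t) * w t ≤ 4
  have hfm : Measurable f := by
    refine ENNReal.measurable_ofReal.comp (Measurable.ite measurableSet_Iio ?_ measurable_const)
    fun_prop
  have hwm : Measurable w := by fun_prop
  have hw_anti : ∀ x y, 0 ≤ x → x ≤ y → w y ≤ w x := fun x y hx hxy =>
    ENNReal.ofReal_le_ofReal
      (Real.rpow_le_rpow_of_nonpos (by linarith) (by linarith) (by norm_num))
  have hf_mono : ∀ x y, x ≤ y → y < r → f x ≤ f y := fun x y hxy hy => by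
    simp only [hf, hy, hxy.trans_lt hy, if_true]
    exact ENNReal.ofReal_le_ofReal
      (Real.rpow_le_rpow_of_nonpos (by linarith) (by linarith) (by norm_num))
  have hF'm : NullMeasurableSet (F ∩ Iio r) volume := hF.inter measurableSet_Iio.nullMeasurableSet
  obtain ⟨b, hb0, d, hd1, hd2⟩ := exists_half_measure (A := F ∩ Iio r) hr.le
    (fun x hx => ⟨hF0 hx.1, hx.2⟩)
  set P := F ∩ Iio r ∩ Iio d
  set Q := F ∩ Iio r ∩ Ici d
  have hPF : P ⊆ F := inter_subset_left.trans inter_subset_left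
  have hQF : Q ⊆ F := inter_subset_left.trans inter_subset_left
  have hPm : NullMeasurableSet P volume := hF'm.inter measurableSet_Iio.nullMeasurableSet
  have hQm : NullMeasurableSet Q volume := hF'm.inter measurableSet_Ici.nullMeasurableSet
  have hZm : NullMeasurableSet (F ∩ Ici r) volume := hF.inter measurableSet_Ici.nullMeasurableSet
  obtain ⟨hLm, hLv⟩ := hm.measPres P hPF hPm
  obtain ⟨hUm, hUv⟩ := hm.measPres Q hQF hQm
  obtain ⟨hEZm, -⟩ := hm.measPres (F ∩ Ici r) inter_subset_left hZm
  have hcover : E ⊆ (E ∩ m ⁻¹' P) ∪ (E ∩ m ⁻¹' Q) ∪ (E ∩ m ⁻¹' (F ∩ Ici r)) := by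
    intro x hx
    have hxF := hm.bijOn.mapsTo hx
    rcases lt_or_ge (m x) r with h1 | h1
    · rcases lt_or_ge (m x) d with h2 | h2
      · exact Or.inl (Or.inl ⟨hx, ⟨hxF, h1⟩, h2⟩)
      · exact Or.inl (Or.inr ⟨hx, ⟨hxF, h1⟩, h2⟩)
    · exact Or.inr ⟨hx, hxF, h1⟩
  have hL : ∫⁻ t in E ∩ m ⁻¹' P, f (m t) * w t ≤ 2 := by
    calc ∫⁻ t in E ∩ m ⁻¹' P, f (m t) * w t
        ≤ ∫⁻ t in E ∩ m ⁻¹' P, ENNReal.ofReal ((b + 1) ^ (-(1/2) : ℝ)) * w t := by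
          apply lintegral_mono_ae
          filter_upwards [ae_restrict_mem₀ hLm] with t ht
          gcongr
          have hbd : b ≤ r - m t := by
            have h1 : volume Q ≤ volume (Icc (m t) r) :=
              measure_mono fun x hx => ⟨(ht.2.2.trans_le hx.2).le, hx.1.2.le⟩
            rw [hd2, Real.volume_Icc] at h1
            exact (ENNReal.ofReal_le_ofReal_iff (sub_nonneg.2 ht.2.1.2.le)).1 h1
          have htr : m t < r := ht.2.1.2
          simp only [hf, htr, if_true]
          exact ENNReal.ofReal_le_ofReal
            (Real.rpow_le_rpow_of_nonpos (by linarith) (by linarith) (by norm_num))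
      _ = ENNReal.ofReal ((b + 1) ^ (-(1/2) : ℝ)) * ∫⁻ t in E ∩ m ⁻¹' P, w t :=
          lintegral_const_mul _ hwm
      _ ≤ ENNReal.ofReal ((b + 1) ^ (-(1/2) : ℝ)) * ∫⁻ t in Ioc 0 b, w t := by
          refine mul_le_mul' le_rfl ?_
          refine setLIntegral_le_of_superlevel (k := w b) hLm measurableSet_Ioc.nullMeasurableSet
            (by simp) ?_ (fun x hx => hw_anti x b hx.1.le hx.2) fun x hx => hw_anti b x hb0 ?_
          · rw [hLv, hd1]; simp
          · by_contra! h
            exact hx.2 ⟨hE0 hx.1.1, h.le⟩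
      _ ≤ 2 := by
          rw [← ofReal_inv_sqrt_mul_two_sqrt hb0]
          refine mul_le_mul' le_rfl ?_
          exact setLIntegral_inv_sqrt_add_one_le hb0
  have hU : ∫⁻ t in E ∩ m ⁻¹' Q, f (m t) * w t ≤ 2 := by
    calc ∫⁻ t in E ∩ m ⁻¹' Q, f (m t) * w t
        ≤ ∫⁻ t in E ∩ m ⁻¹' Q, ENNReal.ofReal ((b + 1) ^ (-(1/2) : ℝ)) * f (m t) := by
          apply lintegral_mono_ae
          filter_upwards [ae_restrict_mem₀ hUm] with t ht
          rw [mul_comm]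
          gcongr
          refine hw_anti b t hb0 ?_
          have h1 : volume (E ∩ m ⁻¹' P) ≤ volume (Ioc 0 t) :=
            measure_mono fun x hx => ⟨hE0 hx.1,
              ((hm.strictMonoOn.lt_iff_lt hx.1 ht.1).1 (hx.2.2.trans_le ht.2.2)).le⟩
          rw [hLv, hd1, Real.volume_Ioc, sub_zero] at h1
          exact (ENNReal.ofReal_le_ofReal_iff (le_of_lt (hE0 ht.1))).1 h1
      _ = ENNReal.ofReal ((b + 1) ^ (-(1/2) : ℝ)) * ∫⁻ t in E ∩ m ⁻¹' Q, f (m t) :=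
          lintegral_const_mul' _ _ ENNReal.ofReal_ne_top
      _ = ENNReal.ofReal ((b + 1) ^ (-(1/2) : ℝ)) * ∫⁻ s in Q, f s := by
          rw [hm.setLIntegral_comp hE hQF hQm hfm]
      _ ≤ ENNReal.ofReal ((b + 1) ^ (-(1/2) : ℝ)) * ∫⁻ s in Ico (r - b) r, f s := by
          refine mul_le_mul' le_rfl ?_
          rcases hb0.eq_or_lt with rfl | hbpos
          · rw [Measure.restrict_eq_zero.2 (by rw [hd2]; simp)]
            simp
          refine setLIntegral_le_of_superlevel (k := f (r - b)) hQm
            measurableSet_Ico.nullMeasurableSet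
            (by simp) ?_ (fun x hx => hf_mono _ _ hx.1 hx.2)
            fun x hx => hf_mono _ _ ?_ (by linarith)
          · rw [hd2]; simp
          · by_contra! h
            exact hx.2 ⟨h.le, hx.1.1.2⟩
      _ ≤ 2 := by
          rw [← ofReal_inv_sqrt_mul_two_sqrt hb0]
          refine mul_le_mul' le_rfl ?_
          exact setLIntegral_inv_sqrt_sub_le hb0
  have hZ : ∫⁻ t in E ∩ m ⁻¹' (F ∩ Ici r), f (m t) * w t ≤ 0 := by
    calc ∫⁻ t in E ∩ m ⁻¹' (F ∩ Ici r), f (m t) * w t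
        ≤ ∫⁻ _ in E ∩ m ⁻¹' (F ∩ Ici r), 0 := by
          apply lintegral_mono_ae
          filter_upwards [ae_restrict_mem₀ hEZm] with t ht
          have htr : ¬ m t < r := not_lt.2 ht.2.2
          simp [hf, htr]
      _ = 0 := lintegral_zero
  calc ∫⁻ t in E, f (m t) * w t
      ≤ ∫⁻ t in (E ∩ m ⁻¹' P) ∪ (E ∩ m ⁻¹' Q) ∪ (E ∩ m ⁻¹' (F ∩ Ici r)), f (m t) * w t :=
        lintegral_mono_set hcover
    _ ≤ _ := lintegral_union_le _ _ _
    _ ≤ ((∫⁻ t in E ∩ m ⁻¹' P, f (m t) * w t) + ∫⁻ t in E ∩ m ⁻¹' Q, f (m t) * w t) +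
          ∫⁻ t in E ∩ m ⁻¹' (F ∩ Ici r), f (m t) * w t := by
        exact add_le_add (lintegral_union_le _ _ _) le_rfl
    _ ≤ (2 + 2) + 0 := add_le_add (add_le_add hL hU) hZ
    _ = 4 := by norm_num

/-- With `W(t) = (t+1)^{-1/2}` and `p = 1`: for every `r > 0`,
`ρ_G(f_r*) ≥ log(r+1)` and `ρ_G(f_r) ≤ 4`, where `f_r(t) = (r+1-t)^{-1/2}` and
`f_r*(t) = (t+1)^{-1/2}` on `(0,r)`, both vanishing on `[r,∞)`. -/
theorem stmt7 (r : ℝ) (hr : 0 < r) :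
    ENNReal.ofReal (Real.log (r + 1)) ≤
      rhoG 1 (fun t => (t + 1) ^ (-(1/2) : ℝ))
        (fun t => ENNReal.ofReal (if t < r then (t + 1) ^ (-(1/2) : ℝ) else 0)) ∧
    rhoG 1 (fun t => (t + 1) ^ (-(1/2) : ℝ))
        (fun t => ENNReal.ofReal (if t < r then (r + 1 - t) ^ (-(1/2) : ℝ) else 0)) ≤ 4 := by
  refine ⟨ofReal_log_le_rhoG hr, ?_⟩
  refine iSup_le fun E => iSup_le fun F => iSup_le fun m => iSup_le fun hE0 => iSup_le fun hF0 =>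
    iSup_le fun hE => iSup_le fun hF => iSup_le fun hm => ?_
  simp only [ENNReal.rpow_one, div_one]
  exact hm.setLIntegral_le_four hr hE0 hF0 hE hF
end

section
/- Fix 1 ≤ p < ∞ and W ∈ 𝕎, write 1_i for the indicator function of (i-1, i] for i ∈ ℕ, and set w(k) = ∫_{k-1}^k W(t) dt for k ∈ ℕ. Then for every finitely supported real sequence (a_i)_{i=1}^∞ and every strictly increasing map k ↦ i_k from ℕ to ℕ, ∑_{k=1}^∞ |a_{i_k}|^p w(k) ≤ ρ_G(|∑_{i=1}^∞ a_i 1_i|)^p; consequently the Garling sequence norm satisfies ‖(a_i)‖_{g(w,p)} ≤ ρ_G(|∑_{i=1}^∞ a_i 1_i|). -/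
open MeasureTheory Set ENNReal Filter

/-- The map that translates each `(k, k+1]` onto `(i k, i k + 1]`. -/
noncomputable def blockShift (i : ℕ → ℕ) (t : ℝ) : ℝ :=
  t + ((i (⌈t⌉₊ - 1) : ℝ) - ((⌈t⌉₊ - 1 : ℕ) : ℝ))

theorem ceil_sub_one_of_mem_Ioc {k : ℕ} {t : ℝ} (ht : t ∈ Ioc (k : ℝ) (k + 1)) :
    ⌈t⌉₊ - 1 = k := by
  have h : ⌈t⌉₊ = k + 1 := by
    rw [Nat.ceil_eq_iff (by omega)]
    simpa using ht
  omega

theorem blockShift_of_mem_Ioc (i : ℕ → ℕ) {k : ℕ} {t : ℝ} (ht : t ∈ Ioc (k : ℝ) (k + 1)) :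
    blockShift i t = t + ((i k : ℝ) - k) := by
  rw [blockShift, ceil_sub_one_of_mem_Ioc ht]

theorem blockShift_mem_Ioc (i : ℕ → ℕ) {k : ℕ} {t : ℝ} (ht : t ∈ Ioc (k : ℝ) (k + 1)) :
    blockShift i t ∈ Ioc (i k : ℝ) (i k + 1) := by
  rw [blockShift_of_mem_Ioc i ht]
  constructor <;> linarith [ht.1, ht.2]

theorem mem_Ioc_ceil_sub_one {t : ℝ} (ht : 0 < t) :
    t ∈ Ioc ((⌈t⌉₊ - 1 : ℕ) : ℝ) ((⌈t⌉₊ - 1 : ℕ) + 1) := by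
  have h1 : 1 ≤ ⌈t⌉₊ := Nat.ceil_pos.2 ht
  rw [Nat.cast_sub h1]
  constructor
  · have := Nat.ceil_lt_add_one ht.le
    push_cast
    linarith
  · simpa using Nat.le_ceil t

theorem iUnion_Ioc_natCast : ⋃ k : ℕ, Ioc (k : ℝ) (k + 1) = Ioi 0 := by
  ext t
  simp only [mem_iUnion, mem_Ioi]
  exact ⟨fun ⟨k, hk⟩ => lt_of_le_of_lt k.cast_nonneg hk.1,
    fun ht => ⟨_, mem_Ioc_ceil_sub_one ht⟩⟩

theorem pairwise_disjoint_Ioc_natCast {i : ℕ → ℕ} (hi : Function.Injective i) :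
    Pairwise (Function.onFun Disjoint fun k : ℕ => Ioc (i k : ℝ) (i k + 1)) := by
  intro k l hkl
  refine Set.disjoint_left.2 fun t hk hl => hkl (hi ?_)
  rw [← ceil_sub_one_of_mem_Ioc hk, ceil_sub_one_of_mem_Ioc hl]

theorem strictMonoOn_blockShift {i : ℕ → ℕ} (hi : StrictMono i) :
    StrictMonoOn (blockShift i) (Ioi 0) := by
  intro s hs t ht hst
  have hs' := mem_Ioc_ceil_sub_one hs
  have ht' := mem_Ioc_ceil_sub_one ht
  have hkl : ⌈s⌉₊ - 1 ≤ ⌈t⌉₊ - 1 := Nat.sub_le_sub_right (Nat.ceil_mono hst.le) 1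
  generalize ⌈s⌉₊ - 1 = k at *
  generalize ⌈t⌉₊ - 1 = l at *
  rcases hkl.eq_or_lt with rfl | hlt
  · rw [blockShift_of_mem_Ioc i hs', blockShift_of_mem_Ioc i ht']
    linarith
  · have h : (i k : ℝ) + 1 ≤ i l := by exact_mod_cast hi hlt
    linarith [(blockShift_mem_Ioc i hs').2, (blockShift_mem_Ioc i ht').1]

theorem bijOn_blockShift {i : ℕ → ℕ} (hi : StrictMono i) :
    BijOn (blockShift i) (Ioi 0) (⋃ k : ℕ, Ioc (i k : ℝ) (i k + 1)) := by
  refine ⟨fun t ht => mem_iUnion.2 ⟨_, blockShift_mem_Ioc i (mem_Ioc_ceil_sub_one ht)⟩,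
    (strictMonoOn_blockShift hi).injOn, fun y hy => ?_⟩
  obtain ⟨k, hk⟩ := mem_iUnion.1 hy
  have ht : y - ((i k : ℝ) - k) ∈ Ioc (k : ℝ) (k + 1) := by
    constructor <;> linarith [hk.1, hk.2]
  refine ⟨_, lt_of_le_of_lt k.cast_nonneg ht.1, ?_⟩
  rw [blockShift_of_mem_Ioc i ht]
  ring

theorem Ioi_inter_preimage_blockShift (i : ℕ → ℕ) (A : Set ℝ) :
    Ioi 0 ∩ blockShift i ⁻¹' A =
      ⋃ k : ℕ, (fun t : ℝ => t + ((i k : ℝ) - k)) ⁻¹' (Ioc (i k : ℝ) (i k + 1) ∩ A) := by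
  rw [← iUnion_Ioc_natCast, iUnion_inter]
  refine iUnion_congr fun k => ?_
  ext t
  have hIoc : t + ((i k : ℝ) - k) ∈ Ioc (i k : ℝ) (i k + 1) ↔ t ∈ Ioc (k : ℝ) (k + 1) := by
    constructor <;> rintro ⟨h1, h2⟩ <;> constructor <;> linarith
  simp only [mem_inter_iff, mem_preimage, hIoc]
  exact and_congr_right fun ht => by rw [blockShift_of_mem_Ioc i ht]

theorem image_blockShift (i : ℕ → ℕ) {B : Set ℝ} (hB : B ⊆ Ioi 0) :
    blockShift i '' B =
      ⋃ k : ℕ, (fun t : ℝ => t + ((i k : ℝ) - k)) '' (B ∩ Ioc (k : ℝ) (k + 1)) := by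
  conv_lhs => rw [← inter_eq_left.2 hB, ← iUnion_Ioc_natCast, inter_iUnion, image_iUnion]
  exact iUnion_congr fun k => image_congr fun t ht => blockShift_of_mem_Ioc i ht.2

theorem nullMeasurableSet_preimage_add_right {A : Set ℝ} (hA : NullMeasurableSet A volume)
    (c : ℝ) : NullMeasurableSet ((fun t : ℝ => t + c) ⁻¹' A) volume :=
  hA.preimage (measurePreserving_add_right volume c).quasiMeasurePreserving

theorem nullMeasurableSet_Ioi_inter_preimage_blockShift (i : ℕ → ℕ) {A : Set ℝ}
    (hA : NullMeasurableSet A volume) :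
    NullMeasurableSet (Ioi 0 ∩ blockShift i ⁻¹' A) volume := by
  rw [Ioi_inter_preimage_blockShift]
  exact NullMeasurableSet.iUnion fun k => nullMeasurableSet_preimage_add_right
    (measurableSet_Ioc.nullMeasurableSet.inter hA) _

theorem volume_Ioi_inter_preimage_blockShift {i : ℕ → ℕ} (hi : StrictMono i) {A : Set ℝ}
    (hAF : A ⊆ ⋃ k : ℕ, Ioc (i k : ℝ) (i k + 1)) (hA : NullMeasurableSet A volume) :
    volume (Ioi 0 ∩ blockShift i ⁻¹' A) = volume A := by
  have hnull (k : ℕ) : NullMeasurableSet (Ioc (i k : ℝ) (i k + 1) ∩ A) volume :=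
    measurableSet_Ioc.nullMeasurableSet.inter hA
  conv_rhs => rw [← inter_eq_right.2 hAF, iUnion_inter]
  rw [Ioi_inter_preimage_blockShift, measure_iUnion₀ _ fun k =>
    nullMeasurableSet_preimage_add_right (hnull k) _, measure_iUnion₀ _ hnull]
  · exact tsum_congr fun k => measure_preimage_add_right _ _ _
  · exact fun k l hkl => ((pairwise_disjoint_Ioc_natCast hi.injective hkl).mono
      inter_subset_left inter_subset_left).aedisjoint
  · intro k l hkl
    refine (Disjoint.mono (fun t ht => ?_) (fun t ht => ?_)
      (pairwise_disjoint_Ioc_natCast Function.injective_id hkl)).aedisjoint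
    all_goals
      obtain ⟨⟨h1, h2⟩, -⟩ := ht
      simp only [id, mem_Ioc]
      constructor <;> linarith

theorem moIso_blockShift {i : ℕ → ℕ} (hi : StrictMono i) :
    MOIso (Ioi 0) (⋃ k : ℕ, Ioc (i k : ℝ) (i k + 1)) (blockShift i) where
  bijOn := bijOn_blockShift hi
  strictMonoOn := strictMonoOn_blockShift hi
  measPres A hAF hA := ⟨nullMeasurableSet_Ioi_inter_preimage_blockShift i hA,
    volume_Ioi_inter_preimage_blockShift hi hAF hA⟩
  invMeasPres B hB hBm := by
    have hnull : NullMeasurableSet (blockShift i '' B) volume := by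
      rw [image_blockShift i hB]
      refine NullMeasurableSet.iUnion fun k => ?_
      rw [image_add_right]
      exact nullMeasurableSet_preimage_add_right
        (hBm.inter measurableSet_Ioc.nullMeasurableSet) _
    refine ⟨hnull, ?_⟩
    rw [← volume_Ioi_inter_preimage_blockShift hi
      ((image_mono hB).trans (bijOn_blockShift hi).mapsTo.image_subset) hnull, inter_comm,
      (bijOn_blockShift hi).injOn.preimage_image_inter hB]

theorem tsum_indicator_Ioc_of_mem (a : ℕ → ℝ) {n : ℕ} {t : ℝ}
    (ht : t ∈ Ioc (n : ℝ) (n + 1)) :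
    ∑' j : ℕ, (Ioc (j : ℝ) (j + 1)).indicator (fun _ => a j) t = a n := by
  rw [tsum_eq_single n, indicator_of_mem ht]
  intro j hj
  refine indicator_of_notMem (fun h => hj ?_) _
  rw [← ceil_sub_one_of_mem_Ioc h, ceil_sub_one_of_mem_Ioc ht]

theorem tsum_rpow_le_rhoG (p : ℝ) (hp : 0 ≤ p) (W : ℝ → ℝ) (a : ℕ → ℝ) {i : ℕ → ℕ}
    (hi : StrictMono i) :
    (∑' k : ℕ, ENNReal.ofReal |a (i k)| ^ p *
        (∫⁻ t in Ioc (k : ℝ) (k + 1), ENNReal.ofReal (W t))) ^ (1 / p) ≤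
      rhoG p W (fun t => ENNReal.ofReal
        |∑' j : ℕ, (Ioc (j : ℝ) (j + 1)).indicator (fun _ => a j) t|) := by
  have hF : (⋃ k : ℕ, Ioc (i k : ℝ) (i k + 1)) ⊆ Ioi 0 :=
    iUnion_subset fun k t ht => lt_of_le_of_lt (i k).cast_nonneg ht.1
  have hFm : NullMeasurableSet (⋃ k : ℕ, Ioc (i k : ℝ) (i k + 1)) volume :=
    (MeasurableSet.iUnion fun k => measurableSet_Ioc).nullMeasurableSet
  refine le_trans (le_of_eq ?_) (le_iSup_of_le (Ioi 0) <| le_iSup_of_le _ <|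
    le_iSup_of_le (blockShift i) <| le_iSup_of_le subset_rfl <| le_iSup_of_le hF <|
    le_iSup_of_le measurableSet_Ioi.nullMeasurableSet <| le_iSup_of_le hFm <|
    le_iSup_of_le (moIso_blockShift hi) le_rfl)
  congr 1
  rw [← iUnion_Ioc_natCast, lintegral_iUnion (s := fun k : ℕ => Ioc (k : ℝ) (k + 1))
    (fun k => measurableSet_Ioc) (pairwise_disjoint_Ioc_natCast Function.injective_id)]
  refine tsum_congr fun k => ?_
  rw [← lintegral_const_mul' _ _ (ENNReal.rpow_ne_top_of_nonneg hp ENNReal.ofReal_ne_top)]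
  refine setLIntegral_congr_fun measurableSet_Ioc fun t ht => ?_
  simp only [tsum_indicator_Ioc_of_mem a (blockShift_mem_Ioc i ht)]

/-- For `1 ≤ p < ∞` and `W ∈ 𝕎`, with `1_i = 1_{(i,i+1]}` and weights
`w(k) = ∫_k^{k+1} W(t) dt`: for every finitely supported `a` and strictly increasing
`k ↦ i_k`, `∑_k |a_{i_k}|^p w(k) ≤ ρ_G(|∑ a_i 1_i|)^p`; consequently the Garling sequence
norm of `a` is at most `ρ_G(|∑ a_i 1_i|)`. -/
theorem stmt12 (p : ℝ) (hp : 1 ≤ p) (W : ℝ → ℝ) (hW : memW W)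
    (a : ℕ → ℝ) (ha : (Function.support a).Finite) :
    (∀ i : ℕ → ℕ, StrictMono i →
      ∑' k : ℕ, ENNReal.ofReal |a (i k)| ^ p *
          (∫⁻ t in Ioc (k : ℝ) (k + 1), ENNReal.ofReal (W t)) ≤
        (rhoG p W (fun t => ENNReal.ofReal
          |∑' j : ℕ, (Ioc (j : ℝ) (j + 1)).indicator (fun _ => a j) t|)) ^ p) ∧
    (⨆ (i : ℕ → ℕ) (_ : StrictMono i),
        (∑' k : ℕ, ENNReal.ofReal |a (i k)| ^ p *
          (∫⁻ t in Ioc (k : ℝ) (k + 1), ENNReal.ofReal (W t))) ^ (1 / p)) ≤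
      rhoG p W (fun t => ENNReal.ofReal
        |∑' j : ℕ, (Ioc (j : ℝ) (j + 1)).indicator (fun _ => a j) t|) := by
  have hp0 : 0 < p := by linarith
  refine ⟨fun i hi => ?_, iSup₂_le fun i hi => tsum_rpow_le_rhoG p hp0.le W a hi⟩
  have h := ENNReal.rpow_le_rpow (tsum_rpow_le_rhoG p hp0.le W a hi) hp0.le
  rwa [← ENNReal.rpow_mul, one_div_mul_cancel hp0.ne', ENNReal.rpow_one] at h
end

section
/- Let E be a Lebesgue-measurable subset of ℝ with λ(E) < ∞. Then there exist a Lebesgue-measure-zero subset E₀ of E, a Lebesgue-measure-zero subset D₀ of [0, λ(E)], and a strictly increasing bijection m : E ∖ E₀ → [0, λ(E)] ∖ D₀ such that both m and m⁻¹ are measure-preserving with respect to Lebesgue measure. -/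
open MeasureTheory Set ENNReal

open Filter Topology

theorem LipschitzWith.volume_image_null {g : ℝ → ℝ} (hg : LipschitzWith 1 g) {s : Set ℝ}
    (hs : volume s = 0) : volume (g '' s) = 0 := by
  have h := hg.hausdorffMeasure_image_le zero_le_one s
  rw [hausdorffMeasure_real, hs, mul_zero] at h
  exact nonpos_iff_eq_zero.1 h

section DistributionFunction

variable (μ : Measure ℝ) [IsFiniteMeasure μ]

theorem monotone_measureReal_Iic : Monotone fun x : ℝ ↦ μ.real (Iic x) :=
  fun _ _ h ↦ measureReal_mono (Iic_subset_Iic.2 h)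

theorem lipschitzWith_measureReal_Iic (hμ : μ ≤ volume) :
    LipschitzWith 1 fun x : ℝ ↦ μ.real (Iic x) := by
  refine LipschitzWith.of_le_add fun x y ↦ ?_
  rcases le_total x y with h | h
  · exact (monotone_measureReal_Iic μ h).trans (le_add_of_nonneg_right dist_nonneg)
  · have hsub : μ.real (Iic x) ≤ μ.real (Iic y) + μ.real (Ioc y x) := by
      rw [← Iic_union_Ioc_eq_Iic h]
      exact measureReal_union_le _ _
    have hle : μ.real (Ioc y x) ≤ x - y := by
      refine ENNReal.toReal_le_of_le_ofReal (sub_nonneg.2 h) ?_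
      exact (hμ _).trans Real.volume_Ioc.le
    rw [Real.dist_eq, abs_of_nonneg (sub_nonneg.2 h)]
    linarith

theorem tendsto_measureReal_Iic_atTop :
    Tendsto (fun x : ℝ ↦ μ.real (Iic x)) atTop (𝓝 (μ.real univ)) :=
  (ENNReal.tendsto_toReal (measure_ne_top μ _)).comp (tendsto_measure_Iic_atTop μ)

theorem tendsto_measureReal_Iic_atBot :
    Tendsto (fun x : ℝ ↦ μ.real (Iic x)) atBot (𝓝 0) := by
  have h := tendsto_measure_iInter_atBot (μ := μ) (s := fun x : ℝ ↦ Iic x)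
    (fun _ ↦ measurableSet_Iic.nullMeasurableSet) (fun _ _ h ↦ Iic_subset_Iic.2 h)
    ⟨0, measure_ne_top μ _⟩
  have he : ⋂ x : ℝ, Iic x = ∅ := by
    ext y
    simpa using exists_lt y
  rw [he, measure_empty] at h
  exact (ENNReal.tendsto_toReal ENNReal.zero_ne_top).comp h

theorem measureReal_setOf_measureReal_Iic_le (hμ : μ ≤ volume) {t : ℝ} (ht : 0 ≤ t)
    (htop : t < μ.real univ) : μ.real {x | μ.real (Iic x) ≤ t} = t := by
  have hcont := (lipschitzWith_measureReal_Iic μ hμ).continuous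
  have hmono := monotone_measureReal_Iic μ
  obtain ⟨c, hc⟩ := ((tendsto_measureReal_Iic_atTop μ).eventually_const_lt htop).exists
  have hbdd : BddAbove {x | μ.real (Iic x) ≤ t} :=
    ⟨c, fun x hx ↦ le_of_not_gt fun hcx ↦ (hc.trans_le (hmono hcx.le)).not_ge hx⟩
  rcases eq_empty_or_nonempty {x | μ.real (Iic x) ≤ t} with he | hne
  · rw [he, measureReal_empty]
    refine ht.antisymm (le_of_not_gt fun hpos ↦ ?_)
    obtain ⟨a, ha⟩ := ((tendsto_measureReal_Iic_atBot μ).eventually_lt_const hpos).exists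
    exact (he ▸ (show a ∈ {x | μ.real (Iic x) ≤ t} from ha.le) : a ∈ (∅ : Set ℝ))
  · have hclosed : IsClosed {x | μ.real (Iic x) ≤ t} := isClosed_le hcont continuous_const
    have hmem := hclosed.csSup_mem hne hbdd
    set b := sSup {x | μ.real (Iic x) ≤ t}
    have hIic : {x | μ.real (Iic x) ≤ t} = Iic b :=
      Subset.antisymm (fun x hx ↦ le_csSup hbdd hx) fun x hx ↦ (hmono hx).trans hmem
    rw [hIic]
    have hbc : b ≤ c := le_of_not_gt fun hcb ↦ (hc.trans_le (hmono hcb.le)).not_ge hmem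
    obtain ⟨y, hy, hyt⟩ := intermediate_value_Icc hbc hcont.continuousOn ⟨hmem, hc.le⟩
    have hyb : y ≤ b := hIic.subset (show μ.real (Iic y) ≤ t from hyt.le)
    rw [← hyt, hyb.antisymm hy.1]

theorem map_measureReal_Iic_eq_restrict (hμ : μ ≤ volume) :
    μ.map (fun x : ℝ ↦ μ.real (Iic x)) = volume.restrict (Icc 0 (μ.real univ)) := by
  have hmeas := (lipschitzWith_measureReal_Iic μ hμ).continuous.measurable
  refine Measure.ext_of_Iic _ _ fun t ↦ ?_
  rw [Measure.map_apply hmeas measurableSet_Iic, Measure.restrict_apply measurableSet_Iic]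
  change μ {x | μ.real (Iic x) ≤ t} = _
  rcases lt_or_ge t 0 with ht | ht
  · have h1 : {x | μ.real (Iic x) ≤ t} = ∅ :=
      eq_empty_of_forall_notMem fun x hx ↦ (ht.trans_le measureReal_nonneg).not_ge hx
    have h2 : Iic t ∩ Icc 0 (μ.real univ) = ∅ :=
      eq_empty_of_forall_notMem fun x hx ↦ (ht.trans_le hx.2.1).not_ge hx.1
    rw [h1, h2, measure_empty, measure_empty]
  rcases lt_or_ge t (μ.real univ) with ht' | ht'
  · have h2 : Iic t ∩ Icc 0 (μ.real univ) = Icc 0 t := by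
      ext x
      simp only [mem_inter_iff, mem_Iic, mem_Icc]
      exact ⟨fun h ↦ ⟨h.2.1, h.1⟩, fun h ↦ ⟨h.2, h.1, h.2.trans ht'.le⟩⟩
    rw [h2, Real.volume_Icc, sub_zero, ← ofReal_measureReal,
      measureReal_setOf_measureReal_Iic_le μ hμ ht ht']
  · have h1 : {x | μ.real (Iic x) ≤ t} = univ :=
      eq_univ_of_forall fun x ↦ (measureReal_mono (subset_univ _)).trans ht'
    have h2 : Iic t ∩ Icc 0 (μ.real univ) = Icc 0 (μ.real univ) :=
      inter_eq_right.2 fun x hx ↦ hx.2.trans ht'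
    rw [h1, h2, Real.volume_Icc, sub_zero, ofReal_measureReal]

end DistributionFunction

/-- For every Lebesgue-measurable `E ⊆ ℝ` of finite measure there are
null sets `E₀ ⊆ E` and `D₀ ⊆ [0, λ(E)]` and a strictly increasing bijection
`m : E \ E₀ → [0, λ(E)] \ D₀` such that `m` and `m⁻¹` are measure-preserving. -/
theorem stmt15 (E : Set ℝ) (hE : NullMeasurableSet E volume) (hEfin : volume E < ∞) :
    ∃ E₀ ⊆ E, volume E₀ = 0 ∧
      ∃ D₀ ⊆ Icc (0 : ℝ) (volume E).toReal, volume D₀ = 0 ∧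
        ∃ m : ℝ → ℝ, MOIso (E \ E₀) (Icc (0 : ℝ) (volume E).toReal \ D₀) m := by
  have : IsFiniteMeasure (volume.restrict E) := ⟨by simpa using hEfin⟩
  set μ : Measure ℝ := volume.restrict E with hμdef
  have hμ : μ ≤ volume := Measure.restrict_le_self
  have huniv : μ.real univ = (volume E).toReal := by
    rw [measureReal_def, hμdef, Measure.restrict_apply_univ]
  have hmap := map_measureReal_Iic_eq_restrict μ hμ
  have hlip := lipschitzWith_measureReal_Iic μ hμ
  have hmono := monotone_measureReal_Iic μ
  have hrange : ∀ x : ℝ, μ.real (Iic x) ∈ Icc 0 (volume E).toReal := fun x ↦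
    ⟨measureReal_nonneg, huniv ▸ measureReal_mono (subset_univ _)⟩
  rw [huniv] at hmap
  set g : ℝ → ℝ := fun x ↦ μ.real (Iic x)
  have hmeas := hlip.continuous.measurable
  have hqmp : Measure.QuasiMeasurePreserving g μ volume :=
    ⟨hmeas, hmap ▸ Measure.restrict_le_self.absolutelyContinuous⟩
  set C : Set ℝ := {c | ∃ x y, x < y ∧ g x = c ∧ g y = c}
  have hC : C.Countable := hmono.countable_setOfPred_two_preimages
  have huniq : ∀ x y, g x ∉ C → g x = g y → x = y := by
    intro x y hx hxy
    rcases lt_trichotomy x y with h | h | h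
    · exact (hx ⟨x, y, h, rfl, hxy.symm⟩).elim
    · exact h
    · exact (hx ⟨y, x, h, hxy.symm, rfl⟩).elim
  have hnull : volume (E ∩ g ⁻¹' C) = 0 := by
    rw [← Measure.restrict_eq_self volume (inter_subset_left : E ∩ g ⁻¹' C ⊆ E)]
    exact measure_mono_null inter_subset_right (hqmp.preimage_null (hC.measure_zero _))
  set S : Set ℝ := E \ (E ∩ g ⁻¹' C) with hSdef
  have hSE : S ⊆ E := sdiff_subset
  have hSC : ∀ x ∈ S, g x ∉ C := fun x hx hxC ↦ hx.2 ⟨hx.1, hxC⟩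
  have hinj : InjOn g S := fun x hx y _ hxy ↦ huniq x y (hSC x hx) hxy
  have hS : NullMeasurableSet S volume := hE.diff (.of_null hnull)
  have hvolS : volume S = volume E := measure_sdiff_null hnull
  have hpre : ∀ B ⊆ S, g ⁻¹' (g '' B) = B := by
    refine fun B hB ↦ Subset.antisymm ?_ (subset_preimage_image g B)
    rintro y ⟨x, hx, hxy⟩
    exact huniq x y (hSC x (hB hx)) hxy ▸ hx
  have himage : ∀ B ⊆ S, NullMeasurableSet B volume →
      NullMeasurableSet (g '' B) volume ∧ volume (g '' B) = volume B := by
    intro B hB hBm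
    have hgB : NullMeasurableSet (g '' B) volume := by
      obtain ⟨B', hB', hB'm, hae⟩ := hBm.exists_measurable_subset_ae_eq
      rw [← union_sdiff_cancel hB', image_union]
      exact (hB'm.image_of_continuousOn_injOn hlip.continuous.continuousOn
        (hinj.mono (hB'.trans hB))).nullMeasurableSet.union
          (.of_null (hlip.volume_image_null (ae_eq_set.1 hae).2))
    refine ⟨hgB, ?_⟩
    have hsub : g '' B ⊆ Icc 0 (volume E).toReal := image_subset_iff.2 fun x _ ↦ hrange x
    rw [← Measure.restrict_eq_self volume hsub, ← hmap, Measure.map_apply₀ hmeas.aemeasurable,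
      hpre B hB, hμdef, Measure.restrict_eq_self volume (hB.trans hSE)]
    rw [hmap]
    exact hgB.mono Measure.restrict_le_self
  obtain ⟨hgS, hvolgS⟩ := himage S subset_rfl hS
  have hgSsub : g '' S ⊆ Icc 0 (volume E).toReal := image_subset_iff.2 fun x _ ↦ hrange x
  refine ⟨E ∩ g ⁻¹' C, inter_subset_left, hnull, Icc 0 (volume E).toReal \ g '' S,
    sdiff_subset, ?_, g, ?_⟩
  · rw [measure_sdiff hgSsub hgS (by rw [hvolgS, hvolS]; exact hEfin.ne), hvolgS, hvolS,
      Real.volume_Icc, sub_zero, ENNReal.ofReal_toReal hEfin.ne, tsub_self]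
  rw [sdiff_sdiff_cancel_left hgSsub, ← hSdef]
  refine ⟨hinj.bijOn_image, fun x hx y hy hxy ↦ ?_, fun A hA hAm ↦ ?_, himage⟩
  · exact (hmono hxy.le).lt_of_ne fun h ↦ hxy.ne (hinj hx hy h)
  · have hSA : g ⁻¹' A ⊆ S := (preimage_mono hA).trans (hpre S subset_rfl).subset
    have hAB : NullMeasurableSet (g ⁻¹' A) volume :=
      (nullMeasurableSet_restrict_of_subset (hSA.trans hSE)).1 (hAm.preimage hqmp)
    rw [inter_eq_right.2 hSA]
    refine ⟨hAB, ?_⟩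
    rw [← (himage _ hSA hAB).2, image_preimage_eq_of_subset (hA.trans (image_subset_range g S))]
end

section
/- Let E and F be Lebesgue-measurable subsets of ℝ, and let m : E → F be a bijection which is strictly increasing and measure-preserving (for every Lebesgue-measurable A ⊆ F, the set m⁻¹(A) is Lebesgue-measurable with λ(m⁻¹(A)) = λ(A)). Then m⁻¹ : F → E is also measure-preserving: for every Lebesgue-measurable A ⊆ E, the image m(A) is Lebesgue-measurable with λ(m(A)) = λ(A). -/
open MeasureTheory Set ENNReal

/-- A strictly increasing bijection onto a null-measurable set maps relatively Borel sets to
null-measurable sets. -/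
theorem StrictMonoOn.nullMeasurableSet_image_inter {E F : Set ℝ} {m : ℝ → ℝ}
    (hF : NullMeasurableSet F volume) (hbij : Set.BijOn m E F) (hmono : StrictMonoOn m E)
    {B : Set ℝ} (hB : MeasurableSet B) : NullMeasurableSet (m '' (E ∩ B)) volume := by
  rw [BorelSpace.measurable_eq (α := ℝ), borel_eq_generateFrom_Iic] at hB
  induction B, hB using MeasurableSpace.generateFrom_induction with
  | hC t ht _ =>
    obtain ⟨c, rfl⟩ := ht
    have key : m '' (E ∩ Iic c) = F ∩ lowerClosure (m '' (E ∩ Iic c)) := by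
      apply Subset.antisymm
      · exact subset_inter ((image_mono inter_subset_left).trans hbij.mapsTo.image_subset)
          subset_lowerClosure
      · rintro y ⟨hy, hy'⟩
        obtain ⟨x, hx, rfl⟩ := hbij.surjOn hy
        obtain ⟨_, ⟨z, ⟨hz, hzc⟩, rfl⟩, hle⟩ := hy'
        exact ⟨x, ⟨hx, ((hmono.le_iff_le hx hz).1 hle).trans hzc⟩, rfl⟩
    rw [key]
    exact hF.inter (lowerClosure _).lower.ordConnected.measurableSet.nullMeasurableSet
  | empty => simp
  | compl t _ ih =>
    have key : m '' (E ∩ tᶜ) = F \ m '' (E ∩ t) := by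
      rw [← sdiff_eq, ← sdiff_self_inter, hbij.injOn.image_sdiff_subset inter_subset_left,
        hbij.image_eq]
    rw [key]
    exact hF.diff ih
  | iUnion s _ ih =>
    rw [inter_iUnion, image_iUnion]
    exact NullMeasurableSet.iUnion ih

/-- If `E, F ⊆ ℝ` are Lebesgue-measurable and `m : E → F` is a strictly
increasing, measure-preserving bijection, then `m⁻¹` is also measure-preserving: the image of
every Lebesgue-measurable `A ⊆ E` is Lebesgue-measurable with the same measure. -/
theorem stmt16 (E F : Set ℝ)
    (hE : NullMeasurableSet E volume) (hF : NullMeasurableSet F volume)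
    (m : ℝ → ℝ) (hbij : Set.BijOn m E F) (hmono : StrictMonoOn m E)
    (hmp : ∀ A : Set ℝ, A ⊆ F → NullMeasurableSet A volume →
      NullMeasurableSet (E ∩ m ⁻¹' A) volume ∧ volume (E ∩ m ⁻¹' A) = volume A) :
    ∀ A : Set ℝ, A ⊆ E → NullMeasurableSet A volume →
      NullMeasurableSet (m '' A) volume ∧ volume (m '' A) = volume A := by
  have hvol : ∀ A ⊆ E, NullMeasurableSet (m '' A) volume → volume (m '' A) = volume A := by
    intro A hA hmA
    rw [← (hmp _ ((image_mono hA).trans hbij.mapsTo.image_subset) hmA).2, inter_comm,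
      hbij.injOn.preimage_image_inter hA]
  have hnull : ∀ N ⊆ E, volume N = 0 → volume (m '' N) = 0 := by
    intro N hN h0
    have hmeas := hmono.nullMeasurableSet_image_inter hF hbij (measurableSet_toMeasurable volume N)
    refine measure_mono_null (image_mono (subset_inter hN (subset_toMeasurable volume N))) ?_
    rw [hvol _ inter_subset_left hmeas]
    exact measure_mono_null inter_subset_right ((measure_toMeasurable N).trans h0)
  intro A hA hAm
  suffices h : NullMeasurableSet (m '' A) volume from ⟨h, hvol A hA h⟩
  obtain ⟨B, hBA, hB, hBae⟩ := hAm.exists_measurable_subset_ae_eq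
  have hBm := hmono.nullMeasurableSet_image_inter hF hbij hB
  rw [inter_eq_right.2 (hBA.trans hA)] at hBm
  rw [← union_sdiff_cancel hBA, image_union]
  exact hBm.union (NullMeasurableSet.of_null
    (hnull _ (sdiff_subset.trans hA) (ae_le_set.1 hBae.symm.le)))
end

section
/- Let E and F be Lebesgue-measurable subsets of ℝ, and let m : F → E be a surjective map which is order-preserving (x ≤ y implies m(x) ≤ m(y)) and measure-preserving (for every Lebesgue-measurable A ⊆ E, the set m⁻¹(A) is Lebesgue-measurable with λ(m⁻¹(A)) = λ(A)). Then there exists a subset F₀ of F with λ(F₀) = 0 such that the restriction of m to F ∖ F₀ is a bijection from F ∖ F₀ onto E. -/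
open MeasureTheory Set ENNReal

/-- A function that is monotone on a set of reals has only countably many fibres with more than
one point. -/
theorem MonotoneOn.countable_setOf_nontrivial_fiber {F : Set ℝ} {m : ℝ → ℝ}
    (hm : MonotoneOn m F) : {y | ∃ a ∈ F, ∃ b ∈ F, a < b ∧ m a = y ∧ m b = y}.Countable := by
  have key : ∀ y, ∃ a b : ℝ, y ∈ {y | ∃ a ∈ F, ∃ b ∈ F, a < b ∧ m a = y ∧ m b = y} →
      a ∈ F ∧ b ∈ F ∧ a < b ∧ m a = y ∧ m b = y := by
    intro y
    by_cases h : ∃ a ∈ F, ∃ b ∈ F, a < b ∧ m a = y ∧ m b = y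
    · obtain ⟨a, ha, b, hb, h⟩ := h
      exact ⟨a, b, fun _ => ⟨ha, hb, h⟩⟩
    · exact ⟨0, 0, fun h' => absurd h' h⟩
  choose a b hab using key
  refine Set.PairwiseDisjoint.countable_of_isOpen (s := fun y => Ioo (a y) (b y)) ?_
    (fun _ _ => isOpen_Ioo) (fun y hy => nonempty_Ioo.2 (hab y hy).2.2.1)
  intro y hy z hz hne
  refine Set.disjoint_left.2 fun x hxy hxz => hne ?_
  obtain ⟨hay, hby, -, may, mby⟩ := hab y hy
  obtain ⟨haz, hbz, -, maz, mbz⟩ := hab z hz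
  have h₁ := hm hay hbz (hxy.1.trans hxz.2).le
  have h₂ := hm haz hby (hxz.1.trans hxy.2).le
  rw [may, mbz] at h₁
  rw [maz, mby] at h₂
  exact le_antisymm h₁ h₂

/-- If `E, F ⊆ ℝ` are Lebesgue-measurable and `m : F → E` is a surjective,
order-preserving, measure-preserving map, then there is a null set `F₀ ⊆ F` such that `m`
restricts to a bijection from `F \ F₀` onto `E`. -/
theorem stmt17 (E F : Set ℝ)
    (hE : NullMeasurableSet E volume) (hF : NullMeasurableSet F volume)
    (m : ℝ → ℝ) (hmaps : Set.MapsTo m F E) (hsurj : Set.SurjOn m F E)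
    (hmono : ∀ x ∈ F, ∀ y ∈ F, x ≤ y → m x ≤ m y)
    (hmp : ∀ A : Set ℝ, A ⊆ E → NullMeasurableSet A volume →
      NullMeasurableSet (F ∩ m ⁻¹' A) volume ∧ volume (F ∩ m ⁻¹' A) = volume A) :
    ∃ F₀ ⊆ F, volume F₀ = 0 ∧ Set.BijOn m (F \ F₀) E := by
  have hsec : ∀ y ∈ E, ∃ x, x ∈ F ∧ m x = y := fun y hy => hsurj hy
  choose! g hgF hmg using hsec
  refine ⟨{x ∈ F | x ≠ g (m x)}, fun x hx => hx.1, ?_, ?_, ?_, ?_⟩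
  · have hm : MonotoneOn m F := fun x hx y hy => hmono x hx y hy
    refine measure_mono_null (t := ⋃ y ∈ {y | ∃ a ∈ F, ∃ b ∈ F, a < b ∧ m a = y ∧ m b = y},
      F ∩ m ⁻¹' {y}) ?_ ((measure_biUnion_null_iff hm.countable_setOf_nontrivial_fiber).2 ?_)
    · rintro x ⟨hx, hne⟩
      refine mem_biUnion (x := m x) ?_ ⟨hx, rfl⟩
      have hg := hgF _ (hmaps hx)
      have hmgx := hmg _ (hmaps hx)
      rcases lt_or_gt_of_ne hne with h | h
      · exact ⟨x, hx, g (m x), hg, h, rfl, hmgx⟩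
      · exact ⟨g (m x), hg, x, hx, h, hmgx, rfl⟩
    · rintro y ⟨a, ha, -, -, -, rfl, -⟩
      rw [(hmp {m a} (singleton_subset_iff.2 (hmaps ha))
        (measurableSet_singleton _).nullMeasurableSet).2, Real.volume_singleton]
  · exact fun x hx => hmaps hx.1
  · rintro x ⟨hx, hx'⟩ y ⟨hy, hy'⟩ hxy
    have h₁ : x = g (m x) := by_contra fun h => hx' ⟨hx, h⟩
    have h₂ : y = g (m y) := by_contra fun h => hy' ⟨hy, h⟩
    rw [h₁, h₂, hxy]
  · intro y hy
    exact ⟨g y, ⟨hgF y hy, fun h => h.2 (by rw [hmg y hy])⟩, hmg y hy⟩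
end

section
/- Let f, g : ℕ → [0,∞) satisfy f(n) → 0 and g(n) → 0 as n → ∞, and suppose f and g are equimeasurable with respect to the counting measure on ℕ: for every s ∈ [0,∞), the sets {n : f(n) > s} and {n : g(n) > s} have the same cardinality (as elements of ℕ ∪ {∞}). Then there exists a bijection m from the support {n : f(n) ≠ 0} onto the support {n : g(n) ≠ 0} such that g(m(n)) = f(n) for every n in the support of f. -/
open MeasureTheory Set Filter

theorem finite_setOf_lt_of_tendsto_zero {f : ℕ → ℝ} (hf : Tendsto f atTop (nhds 0)) {s : ℝ}
    (hs : 0 < s) : {n | s < f n}.Finite := by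
  have h : ∀ᶠ n in cofinite, f n < s := by
    rw [Nat.cofinite_eq_atTop]
    exact hf.eventually_lt_const hs
  exact (eventually_cofinite.mp h).subset fun n hn => not_lt.mpr (le_of_lt hn)

/-- Just below a positive level `t`, a null sequence takes no values. -/
theorem eventually_setOf_lt_eq_setOf_le {f : ℕ → ℝ} (hf : Tendsto f atTop (nhds 0)) {t : ℝ}
    (ht : 0 < t) : ∀ᶠ s in nhdsWithin t (Iio t), {n | s < f n} = {n | t ≤ f n} := by
  have hA := finite_setOf_lt_of_tendsto_zero hf (half_pos ht)
  have h1 : ∀ᶠ s in nhdsWithin t (Iio t), ∀ n ∈ {n | t / 2 < f n}, f n < t → f n < s := by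
    rw [hA.eventually_all]
    intro n _
    by_cases h : f n < t
    · filter_upwards [mem_nhdsWithin_of_mem_nhds (Ioi_mem_nhds h)] with s hs _ using hs
    · exact Eventually.of_forall fun s h' => absurd h' h
  filter_upwards [h1, self_mem_nhdsWithin,
    mem_nhdsWithin_of_mem_nhds (Ioi_mem_nhds (half_lt_self ht))] with s hs hst hs2
  ext n
  refine ⟨fun hn => ?_, fun hn => mem_ofPred.mpr (lt_of_lt_of_le hst hn)⟩
  by_contra hlt
  exact lt_asymm hn (hs n (lt_trans hs2 hn) (not_le.mp hlt))

theorem encard_setOf_eq_add_encard_setOf_lt (f : ℕ → ℝ) (t : ℝ) :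
    {n | f n = t}.encard + {n | t < f n}.encard = {n | t ≤ f n}.encard := by
  rw [← encard_union_eq]
  · congr 1
    ext n
    simp [le_iff_eq_or_lt, eq_comm]
  · exact disjoint_left.mpr fun n (h : f n = t) (h' : t < f n) => h'.ne' h

/-- Equimeasurable null sequences have equinumerous fibres over positive values. -/
theorem encard_fiber_eq_of_equimeasurable {f g : ℕ → ℝ} (hf : Tendsto f atTop (nhds 0))
    (hg : Tendsto g atTop (nhds 0))
    (heq : ∀ s : ℝ, 0 ≤ s → {n | s < f n}.encard = {n | s < g n}.encard) {t : ℝ} (ht : 0 < t) :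
    {n | f n = t}.encard = {n | g n = t}.encard := by
  obtain ⟨s, hsf, hsg, hs⟩ := ((eventually_setOf_lt_eq_setOf_le hf ht).and
    ((eventually_setOf_lt_eq_setOf_le hg ht).and
      (mem_nhdsWithin_of_mem_nhds (Ioi_mem_nhds ht)))).exists
  have h := heq s (le_of_lt hs)
  rw [hsf, hsg, ← encard_setOf_eq_add_encard_setOf_lt, ← encard_setOf_eq_add_encard_setOf_lt,
    heq t ht.le] at h
  have hfin := finite_setOf_lt_of_tendsto_zero hg ht
  exact ENat.add_left_injective_of_ne_top hfin.encard_lt_top.ne h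

/-- If `f, g : ℕ → [0,∞)` tend to `0` and are equimeasurable with respect to
the counting measure on `ℕ`, then there is a bijection `m` from the support of `f` onto the
support of `g` with `g ∘ m = f` on the support of `f`. -/
theorem stmt19 (f g : ℕ → ℝ) (hf0 : ∀ n, 0 ≤ f n) (hg0 : ∀ n, 0 ≤ g n)
    (hf : Tendsto f atTop (nhds 0)) (hg : Tendsto g atTop (nhds 0))
    (heq : ∀ s : ℝ, 0 ≤ s →
      Measure.count {n : ℕ | s < f n} = Measure.count {n : ℕ | s < g n}) :
    ∃ m : ℕ → ℕ, Set.BijOn m (Function.support f) (Function.support g) ∧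
      ∀ n ∈ Function.support f, g (m n) = f n := by
  have heq' : ∀ s : ℝ, 0 ≤ s → {n | s < f n}.encard = {n | s < g n}.encard := fun s hs => by
    simpa [Measure.count_apply] using heq s hs
  have hM : ∀ t : ℝ, ∃ m : ℕ → ℕ, 0 < t → BijOn m {n | f n = t} {n | g n = t} := fun t => by
    by_cases ht : 0 < t
    · have hfin : {n | f n = t}.Finite :=
        (finite_setOf_lt_of_tendsto_zero hf (half_pos ht)).subset
          fun n (hn : f n = t) => mem_ofPred.mpr ((half_lt_self ht).trans_eq hn.symm)
      obtain ⟨m, hm⟩ := hfin.exists_bijOn_of_encard_eq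
        (encard_fiber_eq_of_equimeasurable hf hg heq' ht)
      exact ⟨m, fun _ => hm⟩
    · exact ⟨id, fun h => absurd h ht⟩
  choose M hM using hM
  have hpos : ∀ n ∈ Function.support f, 0 < f n := fun n hn => (hf0 n).lt_of_ne' hn
  have hval : ∀ n ∈ Function.support f, g (M (f n) n) = f n := fun n hn =>
    (hM (f n) (hpos n hn)).mapsTo rfl
  refine ⟨fun n => M (f n) n, ⟨fun n hn => ?_, fun a ha b hb hab => ?_, fun k hk => ?_⟩, hval⟩
  · rw [Function.mem_support, hval n hn]
    exact hn
  · have hfab : f b = f a := by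
      rw [← hval a ha, ← hval b hb]
      exact congrArg g hab.symm
    have hab' : M (f a) a = M (f a) b := by simpa only [hfab] using hab
    exact (hM (f a) (hpos a ha)).injOn rfl hfab hab'
  · obtain ⟨n, hn, hnk⟩ := (hM (g k) ((hg0 k).lt_of_ne' hk)).surjOn (show g k = g k from rfl)
    have hn : f n = g k := hn
    refine ⟨n, ?_, ?_⟩
    · rw [Function.mem_support, hn]
      exact hk
    · simpa only [hn] using hnk
end
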